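/- For the homogeneous XXX chain of N sites of spin l/2, the transfer matrices with two-dimensional auxiliary space commute: t(λ) t(μ) = t(μ) t(λ) as operators on H = ⊗_{n=1}^N ℂ^{l+1}, for all λ, μ ∈ ℂ. -/

import Mathlib

open Matrix Complex

noncomputable section

/-- The spin-l/2 operator `S^z` on ℂ^{l+1}: `S^z e_k = (l/2 − k) e_k`. -/
def Szm (l : ℕ) : Matrix (Fin (l + 1)) (Fin (l + 1)) ℂ :=
  Matrix.of fun i j => if i = j then ((l : ℂ) / 2 - (i : ℕ)) else 0

/-- The spin-l/2 operator `S^−` on ℂ^{l+1}: `S^− e_k = e_{k+1}` (`S^− e_l = 0`). -/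
def Smm (l : ℕ) : Matrix (Fin (l + 1)) (Fin (l + 1)) ℂ :=
  Matrix.of fun i j => if (i : ℕ) = (j : ℕ) + 1 then 1 else 0

/-- The spin-l/2 operator `S^+` on ℂ^{l+1}: `S^+ e_k = k(l+1−k) e_{k−1}` (`S^+ e_0 = 0`). -/
def Spm (l : ℕ) : Matrix (Fin (l + 1)) (Fin (l + 1)) ℂ :=
  Matrix.of fun i j =>
    if (i : ℕ) + 1 = (j : ℕ) then ((j : ℕ) : ℂ) * ((l : ℂ) + 1 - (j : ℕ)) else 0

/-- The (unnormalized) spin-l/2 Lax operator on ℂ² ⊗ ℂ^{l+1}, in 2×2 block form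
`L(λ) = [[λ + η(l/2 + S^z), η S^−],[η S^+, λ + η(l/2 − S^z)]]`. -/
def Lax (η : ℂ) (l : ℕ) (lam : ℂ) :
    Matrix (Fin 2 × Fin (l + 1)) (Fin 2 × Fin (l + 1)) ℂ :=
  Matrix.of fun p q =>
    if p.1 = 0 ∧ q.1 = 0 then
      (if p.2 = q.2 then lam + η * ((l : ℂ) / 2) else 0) + η * Szm l p.2 q.2
    else if p.1 = 0 ∧ q.1 = 1 then η * Smm l p.2 q.2
    else if p.1 = 1 ∧ q.1 = 0 then η * Spm l p.2 q.2
    else (if p.2 = q.2 then lam + η * ((l : ℂ) / 2) else 0) - η * Szm l p.2 q.2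

variable {N : ℕ}

/-- Embedding of an operator on ℂ²(aux) ⊗ ℂ^{l+1}(site n) into (aux) ⊗ H,
H = ⊗_{n=1}^N ℂ^{l+1}. -/
def embL (l : ℕ) (n : Fin N)
    (M : Matrix (Fin 2 × Fin (l + 1)) (Fin 2 × Fin (l + 1)) ℂ) :
    Matrix (Fin 2 × (Fin N → Fin (l + 1))) (Fin 2 × (Fin N → Fin (l + 1))) ℂ :=
  Matrix.of fun p q =>
    M (p.1, p.2 n) (q.1, q.2 n) *
      ∏ j : Fin N, if j = n then 1 else (if p.2 j = q.2 j then 1 else 0)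

/-- The monodromy matrix with two-dimensional auxiliary space:
`T⁽¹⁾₀(λ) = L₀N(λ) ⋯ L₀₁(λ)` on ℂ²₀ ⊗ H. -/
def T1 (η : ℂ) (l : ℕ) (N : ℕ) (lam : ℂ) :
    Matrix (Fin 2 × (Fin N → Fin (l + 1))) (Fin 2 × (Fin N → Fin (l + 1))) ℂ :=
  ((List.ofFn fun n : Fin N => embL l n (Lax η l lam)).reverse).prod

/-- The operator entry of `T⁽¹⁾(λ)`, so that
`A = blk1 0 0`, `B = blk1 0 1`, `C = blk1 1 0`, `D = blk1 1 1`. -/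
def blk1 (η : ℂ) (l : ℕ) (N : ℕ) (ε ε' : Fin 2) (lam : ℂ) :
    Matrix (Fin N → Fin (l + 1)) (Fin N → Fin (l + 1)) ℂ :=
  Matrix.of fun x y => T1 η l N lam (ε, x) (ε', y)

/-- The transfer matrix `t(λ) = tr₀ T⁽¹⁾₀(λ)`. -/
def tL (η : ℂ) (l : ℕ) (N : ℕ) (lam : ℂ) :
    Matrix (Fin N → Fin (l + 1)) (Fin N → Fin (l + 1)) ℂ :=
  blk1 η l N 0 0 lam + blk1 η l N 1 1 lam

/-- The block of an operator on `ℂ² ⊗ V` indexed by a pair of auxiliary basis vectors. -/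
def auxBlock {V : Type*} (M : Matrix (Fin 2 × V) (Fin 2 × V) ℂ) (i j : Fin 2) : Matrix V V ℂ :=
  Matrix.of fun x y => M (i, x) (j, y)

lemma auxBlock_mul {V : Type*} [Fintype V] (M M' : Matrix (Fin 2 × V) (Fin 2 × V) ℂ)
    (i j : Fin 2) :
    auxBlock (M * M') i j = ∑ a, auxBlock M i a * auxBlock M' a j := by
  ext x y
  simp [auxBlock, Matrix.mul_apply, Fintype.sum_prod_type]

lemma auxBlock_one {V : Type*} [DecidableEq V] (i j : Fin 2) :
    auxBlock (1 : Matrix (Fin 2 × V) (Fin 2 × V) ℂ) i j = if i = j then 1 else 0 := by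
  ext x y
  by_cases h : i = j <;> simp [auxBlock, Matrix.one_apply, h]

/-- The Yang–Baxter exchange relation `R(u) X₁ Y₂ = Y₂ X₁ R(u)` with `R(u) = u + η P`,
written for the entries of the `2 × 2` operator-valued matrices `X` and `Y`. -/
def ExchangeRel {A : Type*} [Ring A] [Algebra ℂ A] (η u : ℂ) (X Y : Fin 2 → Fin 2 → A) : Prop :=
  ∀ i j k m, u • (X i j * Y k m) + η • (X k j * Y i m) =
    u • (Y k m * X i j) + η • (Y k j * X i m)

section ExchangeRel

variable {A : Type*} [Ring A] [Algebra ℂ A] {η u : ℂ}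

lemma ExchangeRel.one :
    ExchangeRel η u (fun i j => if i = j then (1 : A) else 0)
      (fun i j => if i = j then (1 : A) else 0) := by
  intro i j k m
  simp only [mul_ite, mul_one, mul_zero]
  congr 2
  split_ifs <;> rfl

lemma ExchangeRel.mul {X X' Y Y' : Fin 2 → Fin 2 → A} (h : ExchangeRel η u X Y)
    (h' : ExchangeRel η u X' Y') (hXY : ∀ i j k m, Commute (X i j) (Y' k m))
    (hYX : ∀ i j k m, Commute (X' i j) (Y k m)) :
    ExchangeRel η u (fun i j => ∑ a, X i a * X' a j) (fun i j => ∑ a, Y i a * Y' a j) := by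
  have left (i j k m) : (∑ a, X i a * X' a j) * (∑ b, Y k b * Y' b m) =
      ∑ a, ∑ b, X i a * Y k b * (X' a j * Y' b m) := by
    rw [Finset.sum_mul_sum]
    refine Finset.sum_congr rfl fun a _ => Finset.sum_congr rfl fun b _ => ?_
    rw [mul_assoc, ← mul_assoc (X' a j), (hYX a j k b).eq]
    simp only [mul_assoc]
  have right (i j k m) : (∑ b, Y k b * Y' b m) * (∑ a, X i a * X' a j) =
      ∑ a, ∑ b, Y k b * X i a * (Y' b m * X' a j) := by
    rw [Finset.sum_mul_sum, Finset.sum_comm]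
    refine Finset.sum_congr rfl fun a _ => Finset.sum_congr rfl fun b _ => ?_
    rw [mul_assoc, ← mul_assoc (Y' b m), ← (hXY i a b m).eq]
    simp only [mul_assoc]
  intro i j k m
  rw [left, left, right, right]
  calc
    _ = ∑ a, ∑ b, (u • (X i a * Y k b) + η • (X k a * Y i b)) * (X' a j * Y' b m) := by
      simp only [Finset.smul_sum, add_mul, smul_mul_assoc, Finset.sum_add_distrib]
    _ = ∑ a, ∑ b, (u • (Y k b * X i a) + η • (Y k a * X i b)) * (X' a j * Y' b m) := by
      simp only [h i _ k _]
    _ = ∑ a, ∑ b, Y k b * X i a * (u • (X' a j * Y' b m) + η • (X' b j * Y' a m)) := by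
      simp only [add_mul, mul_add, smul_mul_assoc, mul_smul_comm, Finset.sum_add_distrib]
      rw [add_right_inj, Finset.sum_comm]
    _ = _ := by
      simp only [h' _ j _ m]
      simp only [Finset.smul_sum, mul_add, mul_smul_comm, Finset.sum_add_distrib]

lemma ExchangeRel.trace_commute {X Y : Fin 2 → Fin 2 → A} (h : ExchangeRel η u X Y)
    (hu : u ^ 2 - η ^ 2 ≠ 0) : Commute (X 0 0 + X 1 1) (Y 0 0 + Y 1 1) := by
  have key : (u ^ 2 - η ^ 2) •
      ((X 0 0 + X 1 1) * (Y 0 0 + Y 1 1) - (Y 0 0 + Y 1 1) * (X 0 0 + X 1 1)) = 0 := by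
    have h1 := h 0 0 0 0
    have h2 := h 0 0 1 1
    have h3 := h 1 1 0 0
    have h4 := h 1 1 1 1
    have h5 := h 0 1 1 0
    have h6 := h 1 0 0 1
    simp only [mul_add, add_mul]
    linear_combination (norm := module) u • (h1 + h2 + h3 + h4) - η • (h1 + h4 + h5 + h6)
  exact sub_eq_zero.mp ((smul_eq_zero_iff_right hu).mp key)

end ExchangeRel

lemma Spm_mul_Smm_sub (l : ℕ) : Spm l * Smm l - Smm l * Spm l = (2 : ℂ) • Szm l := by
  have h1 : Spm l * Smm l =
      Matrix.diagonal fun i : Fin (l + 1) => ((i : ℕ) + 1 : ℂ) * ((l : ℂ) - (i : ℕ)) := by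
    ext i j
    rw [Matrix.mul_apply, Matrix.diagonal_apply]
    simp only [Spm, Smm, Matrix.of_apply, mul_ite, mul_one, mul_zero]
    by_cases hi : (i : ℕ) + 1 < l + 1
    · rw [Finset.sum_eq_single ⟨i + 1, hi⟩]
      · simp only [Fin.ext_iff, add_left_inj, if_true]
        split_ifs <;> push_cast <;> ring
      · intro k _ hk
        have : ¬ (i : ℕ) + 1 = k := fun e => hk (Fin.ext e.symm)
        simp [this]
      · simp
    · have hl : (i : ℕ) = l := by omega
      rw [Finset.sum_eq_zero]
      · simp [hl]
      · intro k _
        have : ¬ (i : ℕ) + 1 = k := by omega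
        simp [this]
  have h2 : Smm l * Spm l =
      Matrix.diagonal fun i : Fin (l + 1) => ((i : ℕ) : ℂ) * ((l : ℂ) + 1 - (i : ℕ)) := by
    ext i j
    rw [Matrix.mul_apply, Matrix.diagonal_apply]
    simp only [Spm, Smm, Matrix.of_apply, ite_mul, one_mul, zero_mul]
    by_cases hi : (i : ℕ) = 0
    · rw [Finset.sum_eq_zero]
      · simp [hi]
      · intro k _
        have : ¬ (i : ℕ) = k + 1 := by omega
        simp [this]
    · rw [Finset.sum_eq_single ⟨i - 1, by omega⟩]
      · have e : (i : ℕ) - 1 + 1 = i := by omega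
        simp only [Fin.ext_iff, e, if_true]
        split_ifs with h
        · rw [h]
        · rfl
      · intro k _ hk
        have : ¬ (i : ℕ) = k + 1 := fun e => hk (Fin.ext (by simp; omega))
        simp [this]
      · simp
  rw [h1, h2]
  ext i j
  simp only [Matrix.sub_apply, Matrix.diagonal_apply, Matrix.smul_apply, Szm, Matrix.of_apply,
    smul_eq_mul]
  split_ifs <;> ring

lemma Szm_eq_diagonal (l : ℕ) :
    Szm l = Matrix.diagonal fun i : Fin (l + 1) => (l : ℂ) / 2 - (i : ℕ) := by
  ext i j
  simp [Szm, Matrix.diagonal_apply]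

lemma Szm_mul_Smm_sub (l : ℕ) : Szm l * Smm l - Smm l * Szm l = -Smm l := by
  rw [Szm_eq_diagonal]
  ext i j
  simp only [Matrix.sub_apply, Matrix.diagonal_mul, Matrix.mul_diagonal, Matrix.neg_apply, Smm,
    Matrix.of_apply]
  split_ifs with h
  · rw [h]; push_cast; ring
  · ring

lemma Szm_mul_Spm_sub (l : ℕ) : Szm l * Spm l - Spm l * Szm l = Spm l := by
  rw [Szm_eq_diagonal]
  ext i j
  simp only [Matrix.sub_apply, Matrix.diagonal_mul, Matrix.mul_diagonal, Spm, Matrix.of_apply]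
  split_ifs with h
  · rw [← h]; push_cast; ring
  · ring

section Lax

variable (η lam : ℂ) (l : ℕ)

lemma auxBlock_Lax_zero_zero : auxBlock (Lax η l lam) 0 0 =
    (lam + η * (l / 2)) • (1 : Matrix (Fin (l + 1)) (Fin (l + 1)) ℂ) + η • Szm l := by
  ext i j
  simp [auxBlock, Lax, Matrix.one_apply]

lemma auxBlock_Lax_zero_one : auxBlock (Lax η l lam) 0 1 = η • Smm l := by
  ext i j
  simp [auxBlock, Lax]

lemma auxBlock_Lax_one_zero : auxBlock (Lax η l lam) 1 0 = η • Spm l := by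
  ext i j
  simp [auxBlock, Lax]

lemma auxBlock_Lax_one_one : auxBlock (Lax η l lam) 1 1 =
    (lam + η * (l / 2)) • (1 : Matrix (Fin (l + 1)) (Fin (l + 1)) ℂ) - η • Szm l := by
  ext i j
  simp [auxBlock, Lax, Matrix.one_apply]

end Lax

lemma exchangeRel_Lax (η : ℂ) (l : ℕ) (lam mu : ℂ) :
    ExchangeRel η (lam - mu) (auxBlock (Lax η l lam)) (auxBlock (Lax η l mu)) := by
  have hz : Spm l * Smm l = Smm l * Spm l + (2 : ℂ) • Szm l := by
    rw [← Spm_mul_Smm_sub]; abel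
  have hm : Szm l * Smm l = Smm l * Szm l - Smm l := by
    linear_combination (norm := module) Szm_mul_Smm_sub l
  have hp : Szm l * Spm l = Spm l * Szm l + Spm l := by
    linear_combination (norm := module) Szm_mul_Spm_sub l
  simp only [ExchangeRel, Fin.forall_fin_two, auxBlock_Lax_zero_zero, auxBlock_Lax_zero_one,
    auxBlock_Lax_one_zero, auxBlock_Lax_one_one]
  simp only [mul_add, add_mul, mul_sub, sub_mul, smul_mul_smul_comm, one_mul, mul_one, hz, hm, hp]
  refine ⟨⟨⟨⟨?_, ?_⟩, ?_, ?_⟩, ⟨?_, ?_⟩, ?_, ?_⟩, ⟨⟨?_, ?_⟩, ?_, ?_⟩, ⟨?_, ?_⟩, ?_, ?_⟩ <;>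
    first | trivial | module

/-- The operator on `⨂ ℂ^{l+1}` acting by `M` at site `n`. -/
def siteOp (l : ℕ) (n : Fin N) (M : Matrix (Fin (l + 1)) (Fin (l + 1)) ℂ) :
    Matrix (Fin N → Fin (l + 1)) (Fin N → Fin (l + 1)) ℂ :=
  Matrix.of fun x y =>
    M (x n) (y n) * ∏ j : Fin N, if j = n then 1 else (if x j = y j then 1 else 0)

lemma auxBlock_embL (l : ℕ) (n : Fin N)
    (M : Matrix (Fin 2 × Fin (l + 1)) (Fin 2 × Fin (l + 1)) ℂ) (i j : Fin 2) :
    auxBlock (embL l n M) i j = siteOp l n (auxBlock M i j) := rfl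

section siteOp

variable {l : ℕ}

lemma siteOp_mulVec (n : Fin N) (M : Matrix (Fin (l + 1)) (Fin (l + 1)) ℂ)
    (f : (Fin N → Fin (l + 1)) → ℂ) (x : Fin N → Fin (l + 1)) :
    (siteOp l n M *ᵥ f) x = ∑ a, M (x n) a * f (Function.update x n a) := by
  symm
  refine Fintype.sum_of_injective (Function.update x n) (Function.update_injective x n) _ _ ?_ ?_
  · intro y hy
    have : ∃ j, j ≠ n ∧ x j ≠ y j := by
      by_contra! h
      refine hy ⟨y n, funext fun j => ?_⟩
      by_cases hj : j = n
      · subst hj; simp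
      · simp [hj, h j hj]
    obtain ⟨j, hj, hxy⟩ := this
    have hprod : (∏ j : Fin N, if j = n then (1 : ℂ) else (if x j = y j then 1 else 0)) = 0 :=
      Finset.prod_eq_zero (Finset.mem_univ j) (by simp [hj, hxy])
    simp [siteOp, hprod]
  · intro a
    have hprod : (∏ j : Fin N, if j = n then (1 : ℂ) else
        (if x j = Function.update x n a j then 1 else 0)) = 1 :=
      Finset.prod_eq_one fun j _ => by by_cases hj : j = n <;> simp [hj]
    simp [siteOp, hprod]

lemma siteOp_mul (n : Fin N) (M M' : Matrix (Fin (l + 1)) (Fin (l + 1)) ℂ) :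
    siteOp l n (M * M') = siteOp l n M * siteOp l n M' := by
  refine Matrix.mulVec_injective (funext fun f => funext fun x => ?_)
  rw [← Matrix.mulVec_mulVec]
  simp only [siteOp_mulVec, Function.update_self, Function.update_idem, Matrix.mul_apply,
    Finset.sum_mul, Finset.mul_sum, mul_assoc]
  exact Finset.sum_comm

lemma siteOp_commute {n m : Fin N} (h : n ≠ m) (M M' : Matrix (Fin (l + 1)) (Fin (l + 1)) ℂ) :
    Commute (siteOp l n M) (siteOp l m M') := by
  refine Matrix.mulVec_injective (funext fun f => funext fun x => ?_)
  rw [← Matrix.mulVec_mulVec, ← Matrix.mulVec_mulVec]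
  simp only [siteOp_mulVec, Function.update_of_ne h, Function.update_of_ne h.symm, Finset.mul_sum]
  rw [Finset.sum_comm]
  refine Finset.sum_congr rfl fun a _ => Finset.sum_congr rfl fun b _ => ?_
  rw [Function.update_comm h]
  ring

lemma siteOp_add (n : Fin N) (M M' : Matrix (Fin (l + 1)) (Fin (l + 1)) ℂ) :
    siteOp l n (M + M') = siteOp l n M + siteOp l n M' := by
  ext x y
  simp only [siteOp, Matrix.of_apply, Matrix.add_apply]
  ring

lemma siteOp_smul (n : Fin N) (c : ℂ) (M : Matrix (Fin (l + 1)) (Fin (l + 1)) ℂ) :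
    siteOp l n (c • M) = c • siteOp l n M := by
  ext x y
  simp only [siteOp, Matrix.of_apply, Matrix.smul_apply, smul_eq_mul]
  ring

lemma exchangeRel_embL (η lam mu : ℂ) (n : Fin N) :
    ExchangeRel η (lam - mu) (auxBlock (embL l n (Lax η l lam)))
      (auxBlock (embL l n (Lax η l mu))) := by
  intro i j k m
  simp only [auxBlock_embL, ← siteOp_mul, ← siteOp_smul, ← siteOp_add,
    exchangeRel_Lax η l lam mu i j k m]

end siteOp

/-- The ordered product of the Lax operators over a list of sites. -/
def laxProd (η : ℂ) (l : ℕ) (lam : ℂ) (s : List (Fin N)) :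
    Matrix (Fin 2 × (Fin N → Fin (l + 1))) (Fin 2 × (Fin N → Fin (l + 1))) ℂ :=
  (s.map fun n => embL l n (Lax η l lam)).prod

section laxProd

variable (η lam mu : ℂ) (l : ℕ)

lemma auxBlock_laxProd_cons (n : Fin N) (s : List (Fin N)) :
    auxBlock (laxProd η l lam (n :: s)) = fun i j =>
      ∑ a, auxBlock (embL l n (Lax η l lam)) i a * auxBlock (laxProd η l lam s) a j := by
  funext i j
  rw [← auxBlock_mul]
  simp [laxProd]

lemma auxBlock_laxProd_nil :
    auxBlock (laxProd η l lam ([] : List (Fin N))) = fun i j => if i = j then 1 else 0 := by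
  funext i j
  simp [laxProd, auxBlock_one]

lemma siteOp_commute_laxProd {n : Fin N} (M : Matrix (Fin (l + 1)) (Fin (l + 1)) ℂ)
    {s : List (Fin N)} (hs : n ∉ s) (i j : Fin 2) :
    Commute (siteOp l n M) (auxBlock (laxProd η l lam s) i j) := by
  induction s generalizing i j with
  | nil =>
    rw [auxBlock_laxProd_nil]
    beta_reduce
    split_ifs
    · exact Commute.one_right _
    · exact Commute.zero_right _
  | cons m s ih =>
    rw [List.mem_cons, not_or] at hs
    rw [auxBlock_laxProd_cons]
    refine Commute.sum_right _ _ _ fun a _ => ?_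
    rw [auxBlock_embL]
    exact (siteOp_commute hs.1 _ _).mul_right (ih hs.2 a j)

lemma exchangeRel_laxProd {s : List (Fin N)} (hs : s.Nodup) :
    ExchangeRel η (lam - mu) (auxBlock (laxProd η l lam s)) (auxBlock (laxProd η l mu s)) := by
  induction s with
  | nil =>
    rw [auxBlock_laxProd_nil, auxBlock_laxProd_nil]
    exact ExchangeRel.one
  | cons n s ih =>
    rw [List.nodup_cons] at hs
    rw [auxBlock_laxProd_cons, auxBlock_laxProd_cons]
    refine (exchangeRel_embL η lam mu n).mul (ih hs.2) (fun i j k m => ?_) (fun i j k m => ?_)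
    · rw [auxBlock_embL]
      exact siteOp_commute_laxProd η mu l _ hs.1 k m
    · rw [auxBlock_embL]
      exact (siteOp_commute_laxProd η lam l _ hs.1 i j).symm

lemma T1_eq_laxProd (N : ℕ) : T1 η l N lam = laxProd η l lam (List.finRange N).reverse := by
  rw [T1, laxProd, List.map_reverse, List.ofFn_eq_map]

lemma tL_commute_of_ne (N : ℕ) (h : (lam - mu) ^ 2 - η ^ 2 ≠ 0) :
    Commute (tL η l N lam) (tL η l N mu) := by
  have hrel := exchangeRel_laxProd η lam mu l (List.nodup_reverse.mpr (List.nodup_finRange N))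
  rw [← T1_eq_laxProd, ← T1_eq_laxProd] at hrel
  exact hrel.trace_commute h

lemma continuous_Lax : Continuous (Lax η l) := by
  refine continuous_matrix fun p q => ?_
  simp only [Lax, Matrix.of_apply]
  split_ifs <;> fun_prop

lemma continuous_embL (n : Fin N) : Continuous (embL l n) := by
  refine continuous_matrix fun p q => ?_
  simp only [embL, Matrix.of_apply]
  fun_prop

lemma continuous_tL (N : ℕ) : Continuous (tL η l N) := by
  have hT : Continuous (T1 η l N) := by
    simp only [funext fun lam => T1_eq_laxProd η lam l N, laxProd]
    exact continuous_list_prod _ fun n _ => (continuous_embL l n).comp (continuous_Lax η l)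
  refine continuous_matrix fun x y => ?_
  simp only [tL, blk1, Matrix.add_apply, Matrix.of_apply]
  exact (hT.matrix_elem _ _).add (hT.matrix_elem _ _)

end laxProd

/-- the transfer matrices of the homogeneous spin-l/2 XXX chain with
two-dimensional auxiliary space commute: `t(λ) t(μ) = t(μ) t(λ)` for all λ, μ ∈ ℂ. -/
theorem spin_transfer_commute (η : ℂ) (l : ℕ) (hl : 1 ≤ l) (N : ℕ) (lam mu : ℂ) :
    tL η l N lam * tL η l N mu = tL η l N mu * tL η l N lam := by
  have hdense : Dense ({mu + η, mu - η}ᶜ : Set ℂ) :=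
    (Set.toFinite _).countable.dense_compl ℂ
  have hcont := continuous_tL η l N
  refine congrFun (Continuous.ext_on hdense (hcont.mul continuous_const)
    (continuous_const.mul hcont) fun z hz => ?_) lam
  refine tL_commute_of_ne η z mu l N fun h => hz ?_
  have hfac : (z - (mu + η)) * (z - (mu - η)) = 0 := by linear_combination h
  rcases mul_eq_zero.mp hfac with h | h
  · exact Or.inl (sub_eq_zero.mp h)
  · exact Or.inr (sub_eq_zero.mp h)
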